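/- Assume ℓ₁/ω₁ = ℓ₂/ω₂ and let k ≥ 1 be an integer with ξ < ρ/(4k). Let u be a grid location and Y a tuple of at most 2k−1 pairwise distinct grid locations, all distinct from u, with Σ_{YY} positive definite. Then σ²_{u|Y} ≥ σ_s² + σ_n² − (4k/ρ)·σ_s²·ξ² > 0. -/

import Mathlib

open Real

/-- Squared exponential covariance function on ℝ². -/
noncomputable def seCov (σs σn ℓ₁ ℓ₂ : ℝ) (u v : ℝ × ℝ) : ℝ :=
  σs ^ 2 * Real.exp (-((u.1 - v.1) ^ 2) / (2 * ℓ₁ ^ 2) - (u.2 - v.2) ^ 2 / (2 * ℓ₂ ^ 2)) +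
    σn ^ 2 * (if u = v then 1 else 0)

/-- Kernel (covariance) matrix of a finite tuple of locations. -/
noncomputable def kerMat (σs σn ℓ₁ ℓ₂ : ℝ) {ι : Type} [Fintype ι]
    (x : ι → ℝ × ℝ) : Matrix ι ι ℝ :=
  Matrix.of fun j k => seCov σs σn ℓ₁ ℓ₂ (x j) (x k)

/-- Posterior (conditional) variance σ²_{u|x} = σ(u,u) − Σ_{uX} Σ_{XX}⁻¹ Σ_{Xu}. -/
noncomputable def postVar (σs σn ℓ₁ ℓ₂ : ℝ) (u : ℝ × ℝ) {ι : Type} [Fintype ι] [DecidableEq ι]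
    (x : ι → ℝ × ℝ) : ℝ :=
  seCov σs σn ℓ₁ ℓ₂ u u -
    ∑ j, ∑ k, seCov σs σn ℓ₁ ℓ₂ u (x j) * (kerMat σs σn ℓ₁ ℓ₂ x)⁻¹ j k *
      seCov σs σn ℓ₁ ℓ₂ (x k) u

/-- Off the diagonal, the covariance of two grid locations is at most `σs² ξ`. -/
lemma seCov_grid_le {σs σn ℓ₁ ℓ₂ ω₁ ω₂ : ℝ} (hℓ₁ : 0 < ℓ₁) (hℓ₂ : 0 < ℓ₂)
    (hω₁ : 0 < ω₁) (hω₂ : 0 < ω₂) (hnorm : ℓ₁ / ω₁ = ℓ₂ / ω₂) {u v : ℝ × ℝ}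
    (hu : ∃ a b : ℤ, u = ((a : ℝ) * ω₁, (b : ℝ) * ω₂))
    (hv : ∃ a b : ℤ, v = ((a : ℝ) * ω₁, (b : ℝ) * ω₂)) (huv : u ≠ v) :
    seCov σs σn ℓ₁ ℓ₂ u v ≤ σs ^ 2 * Real.exp (-ω₁ ^ 2 / (2 * ℓ₁ ^ 2)) := by
  rw [seCov, if_neg huv, mul_zero, add_zero]
  obtain ⟨a, b, rfl⟩ := hu
  obtain ⟨c, d, rfl⟩ := hv
  have hdist : (1 : ℤ) ≤ (a - c) ^ 2 + (b - d) ^ 2 := by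
    by_contra! h
    have hac : a - c = 0 := by nlinarith [sq_nonneg (a - c), sq_nonneg (b - d)]
    have hbd : b - d = 0 := by nlinarith [sq_nonneg (a - c), sq_nonneg (b - d)]
    obtain rfl : a = c := by lia
    obtain rfl : b = d := by lia
    exact huv rfl
  have hdist' : (1 : ℝ) ≤ ((a : ℝ) - c) ^ 2 + ((b : ℝ) - d) ^ 2 := by exact_mod_cast hdist
  have hℓ : ℓ₂ = ℓ₁ / ω₁ * ω₂ := by rw [hnorm]; field_simp
  have hexp : -((a * ω₁ - c * ω₁) ^ 2) / (2 * ℓ₁ ^ 2) - (b * ω₂ - d * ω₂) ^ 2 / (2 * ℓ₂ ^ 2) =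
      -(((a : ℝ) - c) ^ 2 + ((b : ℝ) - d) ^ 2) * (ω₁ ^ 2 / (2 * ℓ₁ ^ 2)) := by
    rw [hℓ]; field_simp; ring
  have hpos : 0 < ω₁ ^ 2 / (2 * ℓ₁ ^ 2) := by positivity
  have hle : -(((a : ℝ) - c) ^ 2 + ((b : ℝ) - d) ^ 2) * (ω₁ ^ 2 / (2 * ℓ₁ ^ 2)) ≤
      -ω₁ ^ 2 / (2 * ℓ₁ ^ 2) := by
    rw [neg_div]; nlinarith
  dsimp only
  rw [hexp]
  gcongr

lemma seCov_nonneg (σs σn ℓ₁ ℓ₂ : ℝ) (u v : ℝ × ℝ) : 0 ≤ seCov σs σn ℓ₁ ℓ₂ u v := by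
  unfold seCov
  split_ifs <;> positivity

lemma seCov_self (σs σn ℓ₁ ℓ₂ : ℝ) (u : ℝ × ℝ) :
    seCov σs σn ℓ₁ ℓ₂ u u = σs ^ 2 + σn ^ 2 := by
  simp [seCov]

lemma seCov_comm (σs σn ℓ₁ ℓ₂ : ℝ) (u v : ℝ × ℝ) :
    seCov σs σn ℓ₁ ℓ₂ u v = seCov σs σn ℓ₁ ℓ₂ v u := by
  simp only [seCov, eq_comm (a := u), sub_sq_comm u.1, sub_sq_comm u.2]

/-- A Gershgorin-type lower bound on the quadratic form of a matrix with constant diagonal `D`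
and off-diagonal entries of absolute value at most `e`. -/
lemma le_quadForm_of_abs_le {ι : Type*} [Fintype ι] [DecidableEq ι] {A : Matrix ι ι ℝ} {D e : ℝ}
    (hdiag : ∀ i, A i i = D) (hoff : ∀ i j, i ≠ j → |A i j| ≤ e) (w : ι → ℝ) :
    (D - ((Fintype.card ι : ℝ) - 1) * e) * ∑ i, w i ^ 2 ≤ ∑ i, ∑ j, w i * A i j * w j := by
  have hterm : ∀ i j, (if i = j then (D + e) * w i ^ 2 else 0) - e * (w i ^ 2 + w j ^ 2) / 2 ≤
      w i * A i j * w j := by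
    intro i j
    split_ifs with h
    · subst h; rw [hdiag]; nlinarith
    · obtain ⟨h₁, h₂⟩ := abs_le.mp (hoff i j h)
      nlinarith [mul_nonneg (sub_nonneg.2 h₂) (sq_nonneg (w i - w j)),
        mul_nonneg (neg_le_iff_add_nonneg.1 h₁) (sq_nonneg (w i + w j))]
  calc _ = ∑ i, ∑ j, ((if i = j then (D + e) * w i ^ 2 else 0) - e * (w i ^ 2 + w j ^ 2) / 2) := by
        simp only [Finset.sum_sub_distrib, Finset.sum_ite_eq, Finset.mem_univ, if_true,
          ← Finset.sum_div, ← Finset.mul_sum, Finset.sum_add_distrib, Finset.sum_const,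
          Finset.card_univ, nsmul_eq_mul]
        ring
    _ ≤ _ := Finset.sum_le_sum fun i _ => Finset.sum_le_sum fun j _ => hterm i j

/-- If the quadratic form of `A` is at least `m` times the squared norm, that of `A⁻¹` is at most
`m⁻¹` times it. -/
lemma quadForm_inv_le {ι : Type*} [Fintype ι] [DecidableEq ι] {A : Matrix ι ι ℝ}
    (hA : IsUnit A.det) {m : ℝ} (hm : 0 < m)
    (hlow : ∀ w : ι → ℝ, m * ∑ i, w i ^ 2 ≤ ∑ i, ∑ j, w i * A i j * w j) (c : ι → ℝ) :
    ∑ i, ∑ j, c i * A⁻¹ i j * c j ≤ (∑ i, c i ^ 2) / m := by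
  set w := A⁻¹.mulVec c with hw
  have hQ : ∑ i, ∑ j, c i * A⁻¹ i j * c j = ∑ i, c i * w i := by
    simp only [hw, Matrix.mulVec, dotProduct, Finset.mul_sum, mul_assoc]
  have hAw : A.mulVec w = c := by
    rw [hw, Matrix.mulVec_mulVec, Matrix.mul_nonsing_inv A hA, Matrix.one_mulVec]
  have hquad : ∑ i, ∑ j, w i * A i j * w j = ∑ i, c i * w i := by
    refine Finset.sum_congr rfl fun i _ => ?_
    rw [← congrFun hAw i, mul_comm]
    simp only [Matrix.mulVec, dotProduct, Finset.mul_sum, mul_assoc]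
  have hterm : ∀ i, 2 * (c i * w i) - m * w i ^ 2 ≤ c i ^ 2 / m := by
    intro i
    rw [le_div_iff₀ hm]
    nlinarith [sq_nonneg (c i - m * w i)]
  have hsum := Finset.sum_le_sum fun i (_ : i ∈ Finset.univ) => hterm i
  rw [Finset.sum_sub_distrib, ← Finset.mul_sum, ← Finset.mul_sum, ← Finset.sum_div] at hsum
  have := hlow w
  rw [hQ]
  linarith

theorem stmt_13 (σs σn ℓ₁ ℓ₂ ω₁ ω₂ ξ ρ : ℝ)
    (hσs : 0 < σs) (hσn : 0 < σn) (hℓ₁ : 0 < ℓ₁) (hℓ₂ : 0 < ℓ₂)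
    (hω₁ : 0 < ω₁) (hω₂ : 0 < ω₂)
    (hξ : ξ = Real.exp (-ω₁ ^ 2 / (2 * ℓ₁ ^ 2)))
    (hρ : ρ = 1 + σn ^ 2 / σs ^ 2)
    (hnorm : ℓ₁ / ω₁ = ℓ₂ / ω₂)
    (k : ℕ) (hk : 1 ≤ k) (hξρ : ξ < ρ / (4 * (k : ℝ)))
    (u : ℝ × ℝ) (hu : ∃ a b : ℤ, u = ((a : ℝ) * ω₁, (b : ℝ) * ω₂))
    (n : ℕ) (hn : n ≤ 2 * k - 1) (y : Fin n → ℝ × ℝ)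
    (hygrid : ∀ p, ∃ a b : ℤ, y p = ((a : ℝ) * ω₁, (b : ℝ) * ω₂))
    (hyinj : Function.Injective y) (hyu : ∀ p, y p ≠ u)
    (hPD : (kerMat σs σn ℓ₁ ℓ₂ y).PosDef) :
    σs ^ 2 + σn ^ 2 - (4 * (k : ℝ) / ρ) * σs ^ 2 * ξ ^ 2 ≤ postVar σs σn ℓ₁ ℓ₂ u y ∧
    0 < σs ^ 2 + σn ^ 2 - (4 * (k : ℝ) / ρ) * σs ^ 2 * ξ ^ 2 := by
  have hkR : (1 : ℝ) ≤ k := by exact_mod_cast hk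
  have hnR : (n : ℝ) ≤ 2 * k - 1 := by
    have : n + 1 ≤ 2 * k := by lia
    have : (n : ℝ) + 1 ≤ 2 * k := by exact_mod_cast this
    linarith
  have hs : 0 < σs ^ 2 := by positivity
  have hρ0 : 0 < ρ := by rw [hρ]; positivity
  have hD : σs ^ 2 + σn ^ 2 = σs ^ 2 * ρ := by rw [hρ]; field_simp
  have hξ0 : 0 < ξ := by rw [hξ]; positivity
  have hξ1 : ξ < 1 := by
    rw [hξ, Real.exp_lt_one_iff, neg_div, neg_lt_zero]
    positivity
  have hkξ : 4 * k * ξ < ρ := by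
    rw [lt_div_iff₀ (by positivity)] at hξρ
    linarith
  constructor
  · have hoff : ∀ i j, i ≠ j → |kerMat σs σn ℓ₁ ℓ₂ y i j| ≤ σs ^ 2 * ξ := by
      intro i j hij
      rw [kerMat, Matrix.of_apply, abs_of_nonneg (seCov_nonneg ..), hξ]
      exact seCov_grid_le hℓ₁ hℓ₂ hω₁ hω₂ hnorm (hygrid i) (hygrid j) (hyinj.ne hij)
    have hlow : ∀ w : Fin n → ℝ, σs ^ 2 * ρ / 2 * ∑ i, w i ^ 2 ≤
        ∑ i, ∑ j, w i * kerMat σs σn ℓ₁ ℓ₂ y i j * w j := by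
      intro w
      refine le_trans ?_ (le_quadForm_of_abs_le (fun i => seCov_self σs σn ℓ₁ ℓ₂ (y i)) hoff w)
      refine mul_le_mul_of_nonneg_right ?_ (Finset.sum_nonneg fun i _ => sq_nonneg _)
      rw [Fintype.card_fin, hD]
      have : ((n : ℝ) - 1) * ξ ≤ ρ / 2 := by nlinarith
      nlinarith
    have hinv := quadForm_inv_le hPD.det_pos.ne'.isUnit (by positivity) hlow
      fun j => seCov σs σn ℓ₁ ℓ₂ u (y j)
    have hsq : ∑ j, seCov σs σn ℓ₁ ℓ₂ u (y j) ^ 2 ≤ n * (σs ^ 2 * ξ) ^ 2 := by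
      have := Finset.sum_le_card_nsmul Finset.univ (fun j => seCov σs σn ℓ₁ ℓ₂ u (y j) ^ 2)
        ((σs ^ 2 * ξ) ^ 2) fun j _ => pow_le_pow_left₀ (seCov_nonneg ..)
          (hξ ▸ seCov_grid_le hℓ₁ hℓ₂ hω₁ hω₂ hnorm hu (hygrid j) (hyu j).symm) 2
      simpa using this
    have hbound : (∑ j, seCov σs σn ℓ₁ ℓ₂ u (y j) ^ 2) / (σs ^ 2 * ρ / 2) ≤
        4 * k / ρ * σs ^ 2 * ξ ^ 2 := by
      rw [div_le_iff₀ (by positivity)]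
      calc _ ≤ n * (σs ^ 2 * ξ) ^ 2 := hsq
        _ ≤ 2 * k * (σs ^ 2 * ξ) ^ 2 := by gcongr; linarith
        _ = _ := by field_simp; ring
    simp only [postVar, seCov_self, seCov_comm σs σn ℓ₁ ℓ₂ _ u]
    linarith
  · have h₁ : 4 * k / ρ * ξ < 1 := by
      rw [div_mul_eq_mul_div, div_lt_one hρ0]
      exact hkξ
    have h₂ : 4 * k / ρ * ξ * ξ < 1 := by nlinarith
    nlinarith [sq_pos_of_pos hσn]
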